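/- Let n ≥ 1, let k be a positive multiple of 4, and let U be an element of the n-qubit Clifford group C_n. Define Fix(U) := {a ∈ 𝔽₂^{2n} : U·W_a·U^† = W_a or U·W_a·U^† = −W_a}. Then there exists m ∈ ℕ such that |Fix(U)| = 2^m and tr(U^{⊗k} · P_{n,k}) = ((−4)^{k/4}/2)^m. In particular, for k = 4, tr(U^{⊗4} · P_{n,4}) = (−2)^m. -/

import Mathlib

open scoped BigOperators

noncomputable section

/-- `t`-fold tensor (Kronecker) power of a matrix, acting on `(ℂ^α)^{⊗t}`. -/
def tpow {α : Type*} [Fintype α] (M : Matrix α α ℂ) (t : ℕ) :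
    Matrix (Fin t → α) (Fin t → α) ℂ :=
  Matrix.of fun x y => ∏ i, M (x i) (y i)

/-- The rank-one operator `|ψ⟩⟨ψ|`. -/
def rankOne {α : Type*} (ψ : α → ℂ) : Matrix α α ℂ :=
  Matrix.of fun i j => ψ i * (starRingEnd ℂ) (ψ j)

/-- The operator `U_σ` permuting the `t` tensor factors of `(ℂ^α)^{⊗t}`. -/
def permOp (α : Type*) [DecidableEq α] {t : ℕ} (σ : Equiv.Perm (Fin t)) :
    Matrix (Fin t → α) (Fin t → α) ℂ :=
  Matrix.of fun x y => if (fun k => x (σ k)) = y then 1 else 0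

/-- The projector `P_[t]` onto the symmetric subspace `Sym_t(ℂ^α)`. -/
def symProj (α : Type*) [DecidableEq α] (t : ℕ) :
    Matrix (Fin t → α) (Fin t → α) ℂ :=
  (t.factorial : ℂ)⁻¹ • ∑ σ : Equiv.Perm (Fin t), permOp α σ

/-- Single-qubit Pauli matrices labelled by `𝔽₂²`:
`σ_{(0,0)} = I`, `σ_{(0,1)} = X`, `σ_{(1,0)} = Z`, `σ_{(1,1)} = Y`. -/
def pauli (a : ZMod 2 × ZMod 2) : Matrix (ZMod 2) (ZMod 2) ℂ :=
  Matrix.of fun x y =>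
    if a = (0, 0) then (if x = y then 1 else 0)
    else if a = (0, 1) then (if x = y + 1 then 1 else 0)
    else if a = (1, 0) then (if x = y then (if x = 0 then 1 else -1) else 0)
    else (if x = y + 1 then (if x = 0 then -Complex.I else Complex.I) else 0)

/-- The Pauli operator `W_a`, `a ∈ 𝔽₂^{2n}`, on qubits labelled by a finite type `Q`. -/
def PauliW {Q : Type*} [Fintype Q] (a : Q → ZMod 2 × ZMod 2) :
    Matrix (Q → ZMod 2) (Q → ZMod 2) ℂ :=
  Matrix.of fun x y => ∏ i, pauli (a i) (x i) (y i)

/-- The stabilizer projector `P_{n,k} = 2^{-2n}·Σ_{a∈𝔽₂^{2n}} W_a^{⊗k}`. -/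
def stabProj (n k : ℕ) :
    Matrix (Fin k → (Fin n → ZMod 2)) (Fin k → (Fin n → ZMod 2)) ℂ :=
  ((2 : ℂ) ^ (2 * n))⁻¹ • ∑ a : Fin n → ZMod 2 × ZMod 2, tpow (PauliW a) k

/-- A single-qubit gate `G` applied to qubit `i` of `n` qubits (identity elsewhere). -/
def embedGate (n : ℕ) (G : Matrix (ZMod 2) (ZMod 2) ℂ) (i : Fin n) :
    Matrix (Fin n → ZMod 2) (Fin n → ZMod 2) ℂ :=
  Matrix.of fun x y =>
    G (x i) (y i) * ∏ k ∈ Finset.univ.erase i, (if x k = y k then (1 : ℂ) else 0)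

/-- The Hadamard gate `((1+i)/2)·[[1,1],[1,−1]]`. -/
def hGate : Matrix (ZMod 2) (ZMod 2) ℂ :=
  Matrix.of fun x y => (1 + Complex.I) / 2 * (if x = 1 ∧ y = 1 then -1 else 1)

/-- The phase gate `diag(1, −i)`. -/
def sGate : Matrix (ZMod 2) (ZMod 2) ℂ :=
  Matrix.of fun x y => if x = y then (if x = 0 then 1 else -Complex.I) else 0

/-- The CNOT gate with control qubit `i` and target qubit `j`. -/
def cnotGate (n : ℕ) (i j : Fin n) :
    Matrix (Fin n → ZMod 2) (Fin n → ZMod 2) ℂ :=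
  Matrix.of fun x y =>
    if x i = y i ∧ x j = y i + y j ∧ ∀ k, k ≠ i → k ≠ j → x k = y k then 1 else 0

/-- Generators of the `n`-qubit Clifford group: Hadamard and phase gates on each qubit,
CNOT gates on each ordered pair of distinct qubits. -/
def cliffordGens (n : ℕ) : Set (Matrix (Fin n → ZMod 2) (Fin n → ZMod 2) ℂ) :=
  (⋃ i : Fin n, {embedGate n hGate i}) ∪ (⋃ i : Fin n, {embedGate n sGate i}) ∪
    ⋃ (i : Fin n) (j : Fin n) (_ : i ≠ j), {cnotGate n i j}

/-- The `n`-qubit Clifford group: the subgroup of the unitary group `U(2^n)` generated by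
the Hadamard and phase gates on each qubit together with the CNOT gates. -/
def CliffordGroup (n : ℕ) : Subgroup (Matrix.unitaryGroup (Fin n → ZMod 2) ℂ) :=
  Subgroup.closure
    {U : Matrix.unitaryGroup (Fin n → ZMod 2) ℂ |
      (U : Matrix (Fin n → ZMod 2) (Fin n → ZMod 2) ℂ) ∈ cliffordGens n}

open Matrix

section MatrixTensor

variable {ι α : Type*} [Fintype ι]

/-- The tensor product `⊗ᵢ Mᵢ` of a finite family of matrices. -/
def piTensor (M : ι → Matrix α α ℂ) : Matrix (ι → α) (ι → α) ℂ :=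
  Matrix.of fun x y => ∏ i, M i (x i) (y i)

theorem piTensor_apply (M : ι → Matrix α α ℂ) (x y : ι → α) :
    piTensor M x y = ∏ i, M i (x i) (y i) := rfl

theorem piTensor_mul [DecidableEq ι] [Fintype α] (M N : ι → Matrix α α ℂ) :
    piTensor M * piTensor N = piTensor fun i => M i * N i := by
  ext x y
  simp only [piTensor_apply, Matrix.mul_apply, ← Finset.prod_mul_distrib]
  rw [Finset.prod_univ_sum, Fintype.piFinset_univ]

theorem trace_piTensor [DecidableEq ι] [Fintype α] (M : ι → Matrix α α ℂ) :
    (piTensor M).trace = ∏ i, (M i).trace := by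
  simp only [Matrix.trace, Matrix.diag_apply, piTensor_apply]
  rw [Finset.prod_univ_sum, Fintype.piFinset_univ]

theorem conjTranspose_piTensor (M : ι → Matrix α α ℂ) :
    (piTensor M)ᴴ = piTensor fun i => (M i)ᴴ := by
  ext x y
  simp [piTensor_apply, Matrix.conjTranspose_apply]

theorem piTensor_smul (c : ι → ℂ) (M : ι → Matrix α α ℂ) :
    (piTensor fun i => c i • M i) = (∏ i, c i) • piTensor M := by
  ext x y
  simp [piTensor_apply, Finset.prod_mul_distrib]

theorem piTensor_one [DecidableEq ι] [DecidableEq α] :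
    (piTensor fun _ : ι => (1 : Matrix α α ℂ)) = 1 := by
  ext x y
  simp [piTensor_apply, Matrix.one_apply, Finset.prod_ite_zero, funext_iff]

end MatrixTensor

section Pauli

/-- The entries of the single-qubit Pauli matrices, as Gaussian integers. -/
def pauliEntry (a : ZMod 2 × ZMod 2) (x y : ZMod 2) : GaussianInt :=
  if a = (0, 0) then (if x = y then 1 else 0)
  else if a = (0, 1) then (if x = y + 1 then 1 else 0)
  else if a = (1, 0) then (if x = y then (if x = 0 then 1 else -1) else 0)
  else (if x = y + 1 then (if x = 0 then ⟨0, -1⟩ else ⟨0, 1⟩) else 0)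

theorem toComplex_pauliEntry (a : ZMod 2 × ZMod 2) (x y : ZMod 2) :
    (GaussianInt.toComplex (pauliEntry a x y)) = pauli a x y := by
  unfold pauliEntry pauli
  simp only [Matrix.of_apply]
  split_ifs <;> simp [GaussianInt.toComplex_def]

/-- `σ_a σ_b` is `σ_{a+b}` up to a phase. -/
theorem pauli_mul (a b : ZMod 2 × ZMod 2) :
    ∃ c : ℂ, star c * c = 1 ∧ pauli a * pauli b = c • pauli (a + b) := by
  have key : ∀ a b : ZMod 2 × ZMod 2,
      ∃ c ∈ ([1, -1, ⟨0, 1⟩, ⟨0, -1⟩] : List GaussianInt), star c * c = 1 ∧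
        ∀ x y, ∑ z, pauliEntry a x z * pauliEntry b z y = c * pauliEntry (a + b) x y := by
    decide +kernel
  obtain ⟨c, -, hc, h⟩ := key a b
  refine ⟨GaussianInt.toComplex c, ?_, ?_⟩
  · have := congrArg GaussianInt.toComplex hc
    simpa [GaussianInt.toComplex_star] using this
  · ext x y
    have := congrArg GaussianInt.toComplex (h x y)
    simpa only [Matrix.mul_apply, Matrix.smul_apply, smul_eq_mul, ← toComplex_pauliEntry,
      ← map_mul, ← map_sum] using this

theorem pauli_zero : pauli 0 = 1 := by
  ext x y
  rw [Matrix.one_apply, pauli, Matrix.of_apply, if_pos (by rfl)]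

theorem pauli_mul_self (a : ZMod 2 × ZMod 2) : pauli a * pauli a = 1 := by
  have key : ∀ a : ZMod 2 × ZMod 2, ∀ x y,
      ∑ z, pauliEntry a x z * pauliEntry a z y = if x = y then 1 else 0 := by
    decide +kernel
  ext x y
  have := congrArg GaussianInt.toComplex (key a x y)
  rw [Matrix.mul_apply, Matrix.one_apply]
  simpa only [← toComplex_pauliEntry, ← map_mul, ← map_sum, apply_ite GaussianInt.toComplex,
    map_one, map_zero] using this

theorem conjTranspose_pauli (a : ZMod 2 × ZMod 2) : (pauli a)ᴴ = pauli a := by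
  have key : ∀ a : ZMod 2 × ZMod 2, ∀ x y, star (pauliEntry a y x) = pauliEntry a x y := by
    decide +kernel
  ext x y
  rw [Matrix.conjTranspose_apply, ← toComplex_pauliEntry, ← toComplex_pauliEntry, ← key a x y,
    GaussianInt.toComplex_star]
  rfl

theorem trace_pauli_mul (a b : ZMod 2 × ZMod 2) :
    (pauli a * pauli b).trace = if a = b then 2 else 0 := by
  have key : ∀ a b : ZMod 2 × ZMod 2,
      ∑ x, ∑ z, pauliEntry a x z * pauliEntry b z x = if a = b then 2 else 0 := by
    decide +kernel
  have := congrArg GaussianInt.toComplex (key a b)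
  simpa only [Matrix.trace, Matrix.diag_apply, Matrix.mul_apply, ← toComplex_pauliEntry,
    ← map_mul, ← map_sum, apply_ite GaussianInt.toComplex, map_ofNat, map_zero] using this

theorem sum_pauli_mul_pauli (x y z w : ZMod 2) :
    ∑ a, pauli a x y * pauli a z w = if x = w ∧ y = z then 2 else 0 := by
  have key : ∀ x y z w : ZMod 2,
      ∑ a, pauliEntry a x y * pauliEntry a z w = if x = w ∧ y = z then 2 else 0 := by
    decide +kernel
  have := congrArg GaussianInt.toComplex (key x y z w)
  simpa only [← toComplex_pauliEntry,
    ← map_mul, ← map_sum, apply_ite GaussianInt.toComplex, map_ofNat, map_zero] using this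

theorem pauli_conj_pauli (a b : ZMod 2 × ZMod 2) :
    ∃ c : ℂ, (c = 1 ∨ c = -1) ∧ pauli a * pauli b * pauli a = c • pauli b := by
  have key : ∀ a b : ZMod 2 × ZMod 2,
      ∃ c ∈ ([1, -1] : List GaussianInt),
        ∀ x y, ∑ w, (∑ z, pauliEntry a x z * pauliEntry b z w) * pauliEntry a w y =
          c * pauliEntry b x y := by
    decide +kernel
  obtain ⟨c, hc, h⟩ := key a b
  refine ⟨GaussianInt.toComplex c, ?_, ?_⟩
  · rcases (by simpa using hc : c = 1 ∨ c = -1) with rfl | rfl <;> simp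
  · ext x y
    have := congrArg GaussianInt.toComplex (h x y)
    simpa only [Matrix.mul_apply, Matrix.smul_apply, smul_eq_mul, ← toComplex_pauliEntry,
      ← map_mul, ← map_sum] using this

/-- A product of two Pauli entries transforms under CNOT up to a sign. -/
theorem pauli_mul_pauli_cnot (a b : ZMod 2 × ZMod 2) :
    ∃ c : ℂ, ∀ x y z w, pauli a x y * pauli b (x + z) (y + w) =
      c * (pauli (a.1 + b.1, a.2) x y * pauli (b.1, a.2 + b.2) z w) := by
  have key : ∀ a b : ZMod 2 × ZMod 2,
      ∃ c ∈ ([1, -1] : List GaussianInt), ∀ x y z w,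
        pauliEntry a x y * pauliEntry b (x + z) (y + w) =
      c * (pauliEntry (a.1 + b.1, a.2) x y * pauliEntry (b.1, a.2 + b.2) z w) := by
    decide +kernel
  obtain ⟨c, -, h⟩ := key a b
  refine ⟨GaussianInt.toComplex c, fun x y z w => ?_⟩
  simp only [← toComplex_pauliEntry, ← map_mul, h]

end Pauli

section PauliW

variable {Q : Type*} [Fintype Q] [DecidableEq Q]

theorem PauliW_mul (a b : Q → ZMod 2 × ZMod 2) :
    ∃ c : ℂ, star c * c = 1 ∧ PauliW a * PauliW b = c • PauliW (a + b) := by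
  choose c hc h using fun i => pauli_mul (a i) (b i)
  refine ⟨∏ i, c i, ?_, ?_⟩
  · rw [star_prod, ← Finset.prod_mul_distrib, Finset.prod_congr rfl fun i _ => hc i,
      Finset.prod_const_one]
  · change piTensor _ * piTensor _ = _
    rw [piTensor_mul]
    simp only [h]
    exact piTensor_smul _ _

theorem PauliW_zero : PauliW (0 : Q → ZMod 2 × ZMod 2) = 1 := by
  rw [← piTensor_one]
  simp only [← pauli_zero]
  rfl

theorem PauliW_mul_self (a : Q → ZMod 2 × ZMod 2) : PauliW a * PauliW a = 1 := by
  change piTensor _ * piTensor _ = _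
  simp only [piTensor_mul, pauli_mul_self, piTensor_one]

omit [DecidableEq Q] in
theorem conjTranspose_PauliW (a : Q → ZMod 2 × ZMod 2) : (PauliW a)ᴴ = PauliW a := by
  change (piTensor _)ᴴ = _
  simp only [conjTranspose_piTensor, conjTranspose_pauli]
  rfl

theorem trace_PauliW_mul (a b : Q → ZMod 2 × ZMod 2) :
    (PauliW a * PauliW b).trace = if a = b then 2 ^ Fintype.card Q else 0 := by
  change Matrix.trace (piTensor _ * piTensor _) = _
  rw [piTensor_mul, trace_piTensor]
  simp only [trace_pauli_mul, Finset.prod_ite_zero, funext_iff]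
  simp

theorem sum_PauliW_mul_PauliW (x y z w : Q → ZMod 2) :
    ∑ a, PauliW a x y * PauliW a z w = if x = w ∧ y = z then 2 ^ Fintype.card Q else 0 := by
  have h : ∑ a : Q → ZMod 2 × ZMod 2, PauliW a x y * PauliW a z w =
      ∏ i, ∑ a, pauli a (x i) (y i) * pauli a (z i) (w i) := by
    rw [Finset.prod_univ_sum, Fintype.piFinset_univ]
    simp only [Finset.prod_mul_distrib]
    rfl
  rw [h]
  simp only [sum_pauli_mul_pauli, Finset.prod_ite_zero, funext_iff]
  simp [forall_and]

theorem PauliW_conj_PauliW (a b : Q → ZMod 2 × ZMod 2) :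
    ∃ c : ℂ, (c = 1 ∨ c = -1) ∧ PauliW a * PauliW b * PauliW a = c • PauliW b := by
  choose c hc h using fun i => pauli_conj_pauli (a i) (b i)
  refine ⟨∏ i, c i, ?_, ?_⟩
  · refine Finset.prod_induction c (fun z => z = 1 ∨ z = -1) ?_ (Or.inl rfl) fun i _ => hc i
    rintro _ _ (rfl | rfl) (rfl | rfl) <;> simp
  · change piTensor _ * piTensor _ * piTensor _ = _
    simp only [piTensor_mul, h]
    exact piTensor_smul _ _

theorem eq_of_PauliW_eq_smul {a b : Q → ZMod 2 × ZMod 2} {s : ℂ}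
    (h : PauliW a = s • PauliW b) : a = b := by
  by_contra hab
  have h1 := trace_PauliW_mul a a
  nth_rewrite 2 [h] at h1
  rw [Matrix.mul_smul, Matrix.trace_smul, trace_PauliW_mul, if_neg hab, smul_zero,
    if_pos rfl] at h1
  exact pow_ne_zero _ two_ne_zero h1.symm

/-- Frame identity: `∑_a tr(A W_a B W_a) = 2^n tr(A) tr(B)`. -/
theorem sum_trace_mul_PauliW (A B : Matrix (Q → ZMod 2) (Q → ZMod 2) ℂ) :
    ∑ a, (A * PauliW a * B * PauliW a).trace = 2 ^ Fintype.card Q * (A.trace * B.trace) := by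
  have h (a : Q → ZMod 2 × ZMod 2) : (A * PauliW a * B * PauliW a).trace =
      ∑ x, ∑ z, ∑ y, ∑ w, A x w * B y z * (PauliW a w y * PauliW a z x) := by
    simp only [Matrix.trace, Matrix.diag_apply, Matrix.mul_apply, Finset.sum_mul]
    refine Finset.sum_congr rfl fun x _ => Finset.sum_congr rfl fun z _ =>
      Finset.sum_congr rfl fun y _ => Finset.sum_congr rfl fun w _ => by ring
  simp only [h]
  rw [Finset.sum_comm]
  simp only [Finset.sum_comm (s := (Finset.univ : Finset (Q → ZMod 2 × ZMod 2))),
    ← Finset.mul_sum, sum_PauliW_mul_PauliW]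
  simp only [ite_and, Matrix.trace, Matrix.diag_apply, mul_ite, mul_zero, Finset.sum_ite_eq',
    Finset.mem_univ, if_true, ← Finset.sum_mul, ← Finset.mul_sum]
  ring

/-- Parseval: `∑_a tr(A W_a) tr(B W_a) = 2^n tr(A B)`. -/
theorem sum_trace_mul_trace_PauliW (A B : Matrix (Q → ZMod 2) (Q → ZMod 2) ℂ) :
    ∑ a, (A * PauliW a).trace * (B * PauliW a).trace = 2 ^ Fintype.card Q * (A * B).trace := by
  have h (a : Q → ZMod 2 × ZMod 2) : (A * PauliW a).trace * (B * PauliW a).trace =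
      ∑ x, ∑ y, ∑ w, ∑ z, A x w * B y z * (PauliW a w x * PauliW a z y) := by
    simp only [Matrix.trace, Matrix.diag_apply, Matrix.mul_apply, Finset.sum_mul_sum]
    refine Finset.sum_congr rfl fun x _ => Finset.sum_congr rfl fun z _ =>
      Finset.sum_congr rfl fun y _ => Finset.sum_congr rfl fun w _ => by ring
  simp only [h]
  rw [Finset.sum_comm]
  simp only [Finset.sum_comm (s := (Finset.univ : Finset (Q → ZMod 2 × ZMod 2))),
    ← Finset.mul_sum, sum_PauliW_mul_PauliW]
  simp only [ite_and, Matrix.trace, Matrix.diag_apply, Matrix.mul_apply, mul_ite, mul_zero,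
    Finset.sum_ite_irrel, Finset.sum_const_zero, Finset.sum_ite_eq, Finset.sum_ite_eq',
    Finset.mem_univ, if_true, ← Finset.sum_mul]
  ring

end PauliW

section DyadicGaussian

/-- The ring `ℤ[i, 1/2]` of dyadic Gaussian rationals, as a subring of `ℂ`. -/
def dyadicGaussian : Subring ℂ where
  carrier := {z | ∃ (r : ℕ) (g : GaussianInt), 2 ^ r * z = GaussianInt.toComplex g}
  mul_mem' := by
    rintro z w ⟨r, g, h⟩ ⟨s, g', h'⟩
    exact ⟨r + s, g * g', by rw [map_mul, ← h, ← h']; ring⟩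
  one_mem' := ⟨0, 1, by simp⟩
  add_mem' := by
    rintro z w ⟨r, g, h⟩ ⟨s, g', h'⟩
    refine ⟨r + s, 2 ^ s * g + 2 ^ r * g', ?_⟩
    simp only [map_add, map_mul, map_pow, map_ofNat, ← h, ← h']
    ring
  zero_mem' := ⟨0, 0, by simp⟩
  neg_mem' := by
    rintro z ⟨r, g, h⟩
    exact ⟨r, -g, by rw [map_neg, ← h]; ring⟩

theorem toComplex_mem_dyadicGaussian (g : GaussianInt) :
    GaussianInt.toComplex g ∈ dyadicGaussian := ⟨0, g, by simp⟩

theorem star_mem_dyadicGaussian {z : ℂ} (hz : z ∈ dyadicGaussian) : star z ∈ dyadicGaussian := by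
  obtain ⟨r, g, h⟩ := hz
  refine ⟨r, star g, ?_⟩
  rw [GaussianInt.toComplex_star, ← h, map_mul, map_pow, Complex.conj_ofNat]
  rfl

theorem I_mem_dyadicGaussian : Complex.I ∈ dyadicGaussian :=
  ⟨0, ⟨0, 1⟩, by simp [GaussianInt.toComplex_def]⟩

theorem inv_two_mem_dyadicGaussian : (2⁻¹ : ℂ) ∈ dyadicGaussian :=
  ⟨1, 1, by simp⟩

/-- A Gaussian integer of norm `2^N` has fourth power `(-4)^N`, being an associate of
`(1+i)^N`. -/
theorem pow_four_of_sq_add_sq_eq_two_pow (N : ℕ) (a b : ℤ) (h : a ^ 2 + b ^ 2 = 2 ^ N) :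
    ((a : ℂ) + b * Complex.I) ^ 4 = (-4) ^ N := by
  induction N generalizing a b with
  | zero =>
    have ha : a ^ 2 ≤ 1 := by nlinarith [sq_nonneg b]
    have hb : b ^ 2 ≤ 1 := by nlinarith [sq_nonneg a]
    have ha1 : -1 ≤ a ∧ a ≤ 1 := ⟨by nlinarith, by nlinarith⟩
    have hb1 : -1 ≤ b ∧ b ≤ 1 := ⟨by nlinarith, by nlinarith⟩
    obtain ⟨_, _⟩ := ha1
    obtain ⟨_, _⟩ := hb1
    interval_cases a <;> interval_cases b <;>
      simp_all [Complex.I_pow_four, (by decide : Even 4).neg_pow]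
  | succ N ih =>
    have hpar : Even (a + b) := by
      have : Even (a ^ 2 + b ^ 2) := h ▸ (even_two.pow_of_ne_zero (Nat.succ_ne_zero N))
      simpa [Int.even_add, Int.even_pow] using this
    obtain ⟨c, hc⟩ := hpar
    have hb : b = 2 * c - a := by omega
    subst hb
    have hsum : a ^ 2 + (2 * c - a) ^ 2 = 2 * (c ^ 2 + (c - a) ^ 2) := by ring
    have := ih c (c - a) (by rw [pow_succ (2 : ℤ)] at h; linarith)
    rw [pow_succ (-4 : ℂ), ← this]
    have hI : (1 + Complex.I) ^ 4 = -4 := by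
      linear_combination (Complex.I ^ 2 + 4 * Complex.I + 5) * Complex.I_sq
    rw [← hI, ← mul_pow]
    congr 1
    push_cast
    linear_combination (-((c : ℂ) - a)) * Complex.I_sq

theorem pow_four_of_mem_dyadicGaussian {z : ℂ} (hz : z ∈ dyadicGaussian) {m : ℕ}
    (h : z * star z = 2 ^ m) : z ^ 4 = (-4) ^ m := by
  obtain ⟨r, g, hg⟩ := hz
  have hnorm : g.re ^ 2 + g.im ^ 2 = 2 ^ (m + 2 * r) := by
    have h1 : GaussianInt.toComplex g * star (GaussianInt.toComplex g) = 2 ^ (m + 2 * r) := by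
      rw [← hg, star_mul, star_pow, pow_add, ← h]
      simp
      ring
    have h2 : (((g.re ^ 2 + g.im ^ 2 : ℤ)) : ℂ) = ((2 ^ (m + 2 * r) : ℤ) : ℂ) := by
      push_cast
      rw [← h1, GaussianInt.toComplex_def]
      simp
      linear_combination (g.im : ℂ) ^ 2 * Complex.I_sq
    exact_mod_cast h2
  have h4 := pow_four_of_sq_add_sq_eq_two_pow _ _ _ hnorm
  rw [← GaussianInt.toComplex_def, ← hg, mul_pow, pow_add, pow_mul (-4 : ℂ)] at h4
  have h16 : ((2 : ℂ) ^ r) ^ 4 = ((-4) ^ 2) ^ r := by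
    rw [← pow_mul, mul_comm, pow_mul]
    norm_num
  rw [h16, mul_comm] at h4
  exact mul_right_cancel₀ (pow_ne_zero _ (by norm_num)) h4

theorem pauli_mem_dyadicGaussian (a : ZMod 2 × ZMod 2) (x y : ZMod 2) :
    pauli a x y ∈ dyadicGaussian :=
  toComplex_pauliEntry a x y ▸ toComplex_mem_dyadicGaussian _

theorem piTensor_mem_dyadicGaussian {ι α : Type*} [Fintype ι] {M : ι → Matrix α α ℂ}
    (h : ∀ i x y, M i x y ∈ dyadicGaussian) (x y : ι → α) :
    piTensor M x y ∈ dyadicGaussian :=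
  prod_mem fun i _ => h i _ _

end DyadicGaussian

section Clifford

variable {Q : Type*} [Fintype Q] [DecidableEq Q]

/-- A matrix `U` maps every Pauli operator to a multiple of a Pauli operator under
`A ↦ U A Uᴴ`. -/
def NormalizesPauli (U : Matrix (Q → ZMod 2) (Q → ZMod 2) ℂ) : Prop :=
  ∀ a, ∃ (b : Q → ZMod 2 × ZMod 2) (s : ℂ), U * PauliW a * Uᴴ = s • PauliW b

theorem NormalizesPauli.mul {U V : Matrix (Q → ZMod 2) (Q → ZMod 2) ℂ}
    (hU : NormalizesPauli U) (hV : NormalizesPauli V) : NormalizesPauli (U * V) := by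
  intro a
  obtain ⟨b, s, h⟩ := hV a
  obtain ⟨c, t, h'⟩ := hU b
  refine ⟨c, s * t, ?_⟩
  calc U * V * PauliW a * (U * V)ᴴ = U * (V * PauliW a * Vᴴ) * Uᴴ := by
        simp only [Matrix.conjTranspose_mul, Matrix.mul_assoc]
    _ = _ := by rw [h, Matrix.mul_smul, Matrix.smul_mul, h', smul_smul]

theorem NormalizesPauli.conjTranspose {U : Matrix (Q → ZMod 2) (Q → ZMod 2) ℂ}
    (hU : NormalizesPauli U) (h : Uᴴ * U = 1) : NormalizesPauli Uᴴ := by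
  have hback {a b : Q → ZMod 2 × ZMod 2} {s : ℂ} (hab : U * PauliW a * Uᴴ = s • PauliW b) :
      PauliW a = s • (Uᴴ * PauliW b * U) := by
    rw [← Matrix.smul_mul, ← Matrix.mul_smul, ← hab]
    calc PauliW a = (Uᴴ * U) * PauliW a * (Uᴴ * U) := by rw [h, one_mul, mul_one]
      _ = _ := by simp only [Matrix.mul_assoc]
  choose F s hF using hU
  have hs (a) : s a ≠ 0 := by
    intro h0
    have hz := PauliW_mul_self a
    rw [hback (hF a), h0, zero_smul, zero_mul] at hz
    exact zero_ne_one hz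
  have hinj : Function.Injective F := by
    intro a a' haa
    apply eq_of_PauliW_eq_smul (s := s a * (s a')⁻¹)
    rw [hback (hF a), hback (hF a'), haa, smul_smul, inv_mul_cancel_right₀ (hs a')]
  intro b
  obtain ⟨a, rfl⟩ := Finite.injective_iff_surjective.1 hinj b
  refine ⟨a, (s a)⁻¹, ?_⟩
  rw [hback (hF a), smul_smul, inv_mul_cancel₀ (hs a), one_smul, Matrix.conjTranspose_conjTranspose]

theorem normalizesPauli_PauliW (a : Q → ZMod 2 × ZMod 2) : NormalizesPauli (PauliW a) := by
  intro b
  obtain ⟨c, -, h⟩ := PauliW_conj_PauliW a b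
  exact ⟨b, c, by rw [conjTranspose_PauliW, h]⟩

theorem normalizesPauli_piTensor {M : Q → Matrix (ZMod 2) (ZMod 2) ℂ}
    (h : ∀ i a, ∃ (b : ZMod 2 × ZMod 2) (s : ℂ), M i * pauli a * (M i)ᴴ = s • pauli b) :
    NormalizesPauli (piTensor M) := by
  intro a
  choose b s hb using fun i => h i (a i)
  refine ⟨b, ∏ i, s i, ?_⟩
  rw [show PauliW a = piTensor fun i => pauli (a i) from rfl]
  simp only [conjTranspose_piTensor, piTensor_mul, hb]
  exact piTensor_smul s _

theorem embedGate_eq_piTensor (n : ℕ) (G : Matrix (ZMod 2) (ZMod 2) ℂ) (i : Fin n) :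
    embedGate n G i = piTensor (Function.update 1 i G) := by
  ext x y
  rw [embedGate, Matrix.of_apply, piTensor_apply,
    ← Finset.mul_prod_erase _ _ (Finset.mem_univ i), Function.update_self]
  congr 1
  refine Finset.prod_congr rfl fun k hk => ?_
  rw [Function.update_of_ne (Finset.ne_of_mem_erase hk)]
  rfl

theorem normalizesPauli_embedGate {n : ℕ} {G : Matrix (ZMod 2) (ZMod 2) ℂ} (i : Fin n)
    (h : ∀ a, ∃ (b : ZMod 2 × ZMod 2) (s : ℂ), G * pauli a * Gᴴ = s • pauli b) :
    NormalizesPauli (embedGate n G i) := by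
  rw [embedGate_eq_piTensor]
  refine normalizesPauli_piTensor fun k a => ?_
  obtain rfl | hk := eq_or_ne k i
  · simpa using h a
  · exact ⟨a, 1, by simp [Function.update_of_ne hk]⟩

theorem embedGate_mem_dyadicGaussian {n : ℕ} {G : Matrix (ZMod 2) (ZMod 2) ℂ} (i : Fin n)
    (h : ∀ x y, G x y ∈ dyadicGaussian) (x y : Fin n → ZMod 2) :
    embedGate n G i x y ∈ dyadicGaussian := by
  rw [embedGate_eq_piTensor]
  refine piTensor_mem_dyadicGaussian (fun k x y => ?_) x y
  obtain rfl | hk := eq_or_ne k i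
  · simpa using h x y
  · rw [Function.update_of_ne hk, Pi.one_apply, Matrix.one_apply]
    split_ifs
    exacts [one_mem _, zero_mem _]

theorem smul_map_conj_pauli {g : ZMod 2 → ZMod 2 → GaussianInt} {a b : ZMod 2 × ZMod 2}
    {k : GaussianInt} (c : ℂ) (h : ∀ x y, ∑ w, (∑ z, g x z * pauliEntry a z w) * star (g y w) =
      k * pauliEntry b x y) :
    (c • Matrix.of fun x y => GaussianInt.toComplex (g x y)) * pauli a *
      (c • Matrix.of fun x y => GaussianInt.toComplex (g x y))ᴴ =
    (c * star c * GaussianInt.toComplex k) • pauli b := by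
  rw [Matrix.conjTranspose_smul, Matrix.smul_mul, Matrix.smul_mul, Matrix.mul_smul, smul_smul,
    mul_smul (c * star c)]
  congr 1
  ext x y
  have := congrArg GaussianInt.toComplex (h x y)
  simpa only [Matrix.mul_apply, Matrix.smul_apply, smul_eq_mul, ← toComplex_pauliEntry,
    ← map_mul, ← map_sum, Matrix.conjTranspose_apply, Matrix.of_apply, Complex.star_def,
    ← GaussianInt.toComplex_star] using this

theorem hGate_conj_pauli (a : ZMod 2 × ZMod 2) :
    ∃ (b : ZMod 2 × ZMod 2) (s : ℂ), hGate * pauli a * hGateᴴ = s • pauli b := by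
  have key : ∀ a : ZMod 2 × ZMod 2,
      ∃ k ∈ ([2, -2] : List GaussianInt), ∀ x y,
        ∑ w, (∑ z, (if x = 1 ∧ z = 1 then -1 else 1) * pauliEntry a z w) *
          star (if y = 1 ∧ w = 1 then -1 else 1) = k * pauliEntry (a.2, a.1) x y := by
    decide +kernel
  obtain ⟨k, -, h⟩ := key a
  have hH : hGate = ((1 + Complex.I) / 2) • Matrix.of fun x y : ZMod 2 =>
      GaussianInt.toComplex (if x = 1 ∧ y = 1 then -1 else 1) := by
    ext x y
    simp [hGate, apply_ite GaussianInt.toComplex]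
  rw [hH]
  exact ⟨_, _, smul_map_conj_pauli _ h⟩

theorem sGate_conj_pauli (a : ZMod 2 × ZMod 2) :
    ∃ (b : ZMod 2 × ZMod 2) (s : ℂ), sGate * pauli a * sGateᴴ = s • pauli b := by
  have key : ∀ a : ZMod 2 × ZMod 2,
      ∃ k ∈ ([1, -1] : List GaussianInt), ∀ x y,
        ∑ w, (∑ z, (if x = z then (if x = 0 then 1 else ⟨0, -1⟩) else 0) * pauliEntry a z w) *
          star (if y = w then (if y = 0 then 1 else ⟨0, -1⟩) else 0) =
            k * pauliEntry (a.1 + a.2, a.2) x y := by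
    decide +kernel
  obtain ⟨k, -, h⟩ := key a
  have hS : sGate = (1 : ℂ) • Matrix.of fun x y : ZMod 2 =>
      GaussianInt.toComplex (if x = y then (if x = 0 then 1 else ⟨0, -1⟩) else 0) := by
    ext x y
    simp [sGate, apply_ite GaussianInt.toComplex, GaussianInt.toComplex_def]
  rw [hS]
  exact ⟨_, _, smul_map_conj_pauli _ h⟩

theorem cnotGate_apply {n : ℕ} {i j : Fin n} (hij : i ≠ j) (x y : Fin n → ZMod 2) :
    cnotGate n i j x y = if Function.update x j (x i + x j) = y then 1 else 0 := by
  rw [cnotGate, Matrix.of_apply]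
  refine if_congr ?_ rfl rfl
  constructor
  · rintro ⟨hi, hj, h⟩
    ext k
    obtain rfl | hkj := eq_or_ne k j
    · rw [Function.update_self, hi, hj, ← add_assoc, CharTwo.add_self_eq_zero, zero_add]
    · rw [Function.update_of_ne hkj]
      obtain rfl | hki := eq_or_ne k i
      exacts [hi, h k hki hkj]
  · rintro rfl
    refine ⟨by rw [Function.update_of_ne hij], ?_, fun k hki hkj => by
      rw [Function.update_of_ne hkj]⟩
    rw [Function.update_of_ne hij, Function.update_self, ← add_assoc, CharTwo.add_self_eq_zero,
      zero_add]

theorem normalizesPauli_cnotGate {n : ℕ} {i j : Fin n} (hij : i ≠ j) :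
    NormalizesPauli (cnotGate n i j) := by
  intro a
  obtain ⟨c, hc⟩ := pauli_mul_pauli_cnot (a i) (a j)
  refine ⟨Function.update (Function.update a i ((a i).1 + (a j).1, (a i).2)) j
    ((a j).1, (a i).2 + (a j).2), c, ?_⟩
  ext x y
  have hprod (f : Fin n → ℂ) : ∏ k, f k = f i * f j * ∏ k ∈ {i, j}ᶜ, f k := by
    rw [← Finset.prod_mul_prod_compl {i, j}, Finset.prod_pair hij]
  simp only [Matrix.mul_apply, Matrix.conjTranspose_apply, cnotGate_apply hij, ite_mul, one_mul,
    zero_mul, Finset.sum_ite_eq, Finset.mem_univ, if_true, apply_ite star, star_one, star_zero,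
    mul_ite, mul_one, mul_zero, Matrix.smul_apply, smul_eq_mul]
  simp only [PauliW, Matrix.of_apply]
  rw [hprod, hprod, ← mul_assoc]
  congr 1
  · simpa [Function.update_of_ne hij] using hc (x i) (y i) (x j) (y j)
  · refine Finset.prod_congr rfl fun k hk => ?_
    simp only [Finset.mem_compl, Finset.mem_insert, Finset.mem_singleton, not_or] at hk
    simp only [Function.update_of_ne hk.1, Function.update_of_ne hk.2]

theorem mem_dyadicGaussian_of_mem_cliffordGens {n : ℕ}
    {U : Matrix (Fin n → ZMod 2) (Fin n → ZMod 2) ℂ} (hU : U ∈ cliffordGens n)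
    (x y : Fin n → ZMod 2) : U x y ∈ dyadicGaussian := by
  simp only [cliffordGens, Set.mem_union, Set.mem_iUnion, Set.mem_singleton_iff] at hU
  rcases hU with (⟨i, rfl⟩ | ⟨i, rfl⟩) | ⟨i, j, -, rfl⟩
  · refine embedGate_mem_dyadicGaussian i (fun x y => ?_) x y
    rw [hGate, Matrix.of_apply, div_eq_mul_inv]
    refine mul_mem (mul_mem (add_mem (one_mem _) I_mem_dyadicGaussian)
      inv_two_mem_dyadicGaussian) ?_
    split_ifs
    exacts [neg_mem (one_mem _), one_mem _]
  · refine embedGate_mem_dyadicGaussian i (fun x y => ?_) x y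
    rw [sGate, Matrix.of_apply]
    split_ifs
    exacts [one_mem _, neg_mem I_mem_dyadicGaussian, zero_mem _]
  · rw [cnotGate, Matrix.of_apply]
    split_ifs
    exacts [one_mem _, zero_mem _]

theorem normalizesPauli_of_mem_cliffordGens {n : ℕ}
    {U : Matrix (Fin n → ZMod 2) (Fin n → ZMod 2) ℂ} (hU : U ∈ cliffordGens n) :
    NormalizesPauli U := by
  simp only [cliffordGens, Set.mem_union, Set.mem_iUnion, Set.mem_singleton_iff] at hU
  rcases hU with (⟨i, rfl⟩ | ⟨i, rfl⟩) | ⟨i, j, hij, rfl⟩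
  exacts [normalizesPauli_embedGate i hGate_conj_pauli,
    normalizesPauli_embedGate i sGate_conj_pauli, normalizesPauli_cnotGate hij]

theorem normalizesPauli_of_mem_CliffordGroup {n : ℕ}
    {U : Matrix.unitaryGroup (Fin n → ZMod 2) ℂ} (hU : U ∈ CliffordGroup n) :
    NormalizesPauli (U : Matrix (Fin n → ZMod 2) (Fin n → ZMod 2) ℂ) := by
  induction hU using Subgroup.closure_induction with
  | mem U hU => exact normalizesPauli_of_mem_cliffordGens hU
  | one => exact fun a => ⟨a, 1, by simp⟩
  | mul U V _ _ hU hV => exact hU.mul hV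
  | inv U _ hU => exact hU.conjTranspose (Matrix.mem_unitaryGroup_iff'.1 U.2)

theorem mem_dyadicGaussian_of_mem_CliffordGroup {n : ℕ}
    {U : Matrix.unitaryGroup (Fin n → ZMod 2) ℂ} (hU : U ∈ CliffordGroup n)
    (x y : Fin n → ZMod 2) :
    (U : Matrix (Fin n → ZMod 2) (Fin n → ZMod 2) ℂ) x y ∈ dyadicGaussian := by
  induction hU using Subgroup.closure_induction generalizing x y with
  | mem U hU => exact mem_dyadicGaussian_of_mem_cliffordGens hU x y
  | one =>
    rw [Matrix.UnitaryGroup.one_val, Matrix.one_apply]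
    split_ifs
    exacts [one_mem _, zero_mem _]
  | mul U V _ _ hU hV =>
    rw [Matrix.UnitaryGroup.mul_val, Matrix.mul_apply]
    exact sum_mem fun z _ => mul_mem (hU x z) (hV z y)
  | inv U _ hU => exact star_mem_dyadicGaussian (hU y x)

end Clifford

section Fixed

variable {Q : Type*} [Fintype Q] [DecidableEq Q] {U : Matrix (Q → ZMod 2) (Q → ZMod 2) ℂ}

theorem conj_mul_of_conjTranspose_mul (h : Uᴴ * U = 1) (A B : Matrix (Q → ZMod 2) (Q → ZMod 2) ℂ) :
    U * (A * B) * Uᴴ = (U * A * Uᴴ) * (U * B * Uᴴ) := by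
  calc U * (A * B) * Uᴴ = U * A * (Uᴴ * U) * B * Uᴴ := by
        rw [h, mul_one]
        simp only [Matrix.mul_assoc]
    _ = _ := by simp only [Matrix.mul_assoc]

/-- The set of labels `a` with `U W_a Uᴴ = ± W_a`. -/
def pauliFixed (U : Matrix (Q → ZMod 2) (Q → ZMod 2) ℂ) : Set (Q → ZMod 2 × ZMod 2) :=
  {a | U * PauliW a * Uᴴ = PauliW a ∨ U * PauliW a * Uᴴ = -PauliW a}

theorem mem_pauliFixed (h : Uᴴ * U = 1) (h' : U * Uᴴ = 1) {a : Q → ZMod 2 × ZMod 2} :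
    a ∈ pauliFixed U ↔ ∃ s : ℂ, U * PauliW a * Uᴴ = s • PauliW a := by
  constructor
  · rintro (ha | ha)
    exacts [⟨1, by rw [ha, one_smul]⟩, ⟨-1, by rw [ha, neg_one_smul]⟩]
  · rintro ⟨s, hs⟩
    have h1 := conj_mul_of_conjTranspose_mul h (PauliW a) (PauliW a)
    rw [PauliW_mul_self, mul_one, h', hs, smul_mul_smul_comm, PauliW_mul_self] at h1
    have h2 : s * s = 1 := by simpa using (congrFun (congrFun h1 0) 0).symm
    obtain rfl | rfl := mul_self_eq_one_iff.1 h2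
    exacts [Or.inl (by rw [hs, one_smul]), Or.inr (by rw [hs, neg_one_smul])]

theorem conj_PauliW_add (h : Uᴴ * U = 1) {a b : Q → ZMod 2 × ZMod 2} {s t : ℂ}
    (ha : U * PauliW a * Uᴴ = s • PauliW a) (hb : U * PauliW b * Uᴴ = t • PauliW b) :
    U * PauliW (a + b) * Uᴴ = (s * t) • PauliW (a + b) := by
  obtain ⟨c, hc, hab⟩ := PauliW_mul a b
  have hW : PauliW (a + b) = star c • (PauliW a * PauliW b) := by
    rw [hab, smul_smul, hc, one_smul]
  rw [hW, Matrix.mul_smul, Matrix.smul_mul, conj_mul_of_conjTranspose_mul h, ha, hb,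
    smul_mul_smul_comm, smul_comm]

theorem card_pauliFixed (h : Uᴴ * U = 1) (h' : U * Uᴴ = 1) :
    ∃ m : ℕ, (pauliFixed U).ncard = 2 ^ m := by
  let G : AddSubgroup (Q → ZMod 2 × ZMod 2) :=
    { carrier := pauliFixed U
      zero_mem' := Or.inl (by rw [PauliW_zero, mul_one, h'])
      add_mem' := by
        intro a b ha hb
        rw [mem_pauliFixed h h'] at ha hb ⊢
        obtain ⟨s, hs⟩ := ha
        obtain ⟨t, ht⟩ := hb
        exact ⟨s * t, conj_PauliW_add h hs ht⟩
      neg_mem' := by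
        intro a ha
        rwa [show -a = a from funext fun i => Prod.ext (ZMod.neg_eq_self_mod_two _)
          (ZMod.neg_eq_self_mod_two _)] }
  have hdvd : Nat.card G ∣ 2 ^ (2 * Fintype.card Q) := by
    have := G.card_addSubgroup_dvd_card
    rwa [Nat.card_eq_fintype_card (α := Q → ZMod 2 × ZMod 2), Fintype.card_fun, Fintype.card_prod,
      ZMod.card, ← pow_two, ← pow_mul] at this
  obtain ⟨m, -, hm⟩ := (Nat.dvd_prime_pow Nat.prime_two).1 hdvd
  exact ⟨m, hm⟩

/-- The squared modulus of the trace of a Clifford operator is zero or the number of labels it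
fixes. -/
theorem trace_mul_star_trace (h : Uᴴ * U = 1) (h' : U * Uᴴ = 1) (hU : NormalizesPauli U) :
    U.trace * star U.trace = 0 ∨ U.trace * star U.trace = (pauliFixed U).ncard := by
  classical
  have hframe := sum_trace_mul_PauliW U Uᴴ
  rw [Matrix.trace_conjTranspose] at hframe
  have h2 : (2 : ℂ) ^ Fintype.card Q ≠ 0 := pow_ne_zero _ two_ne_zero
  by_cases hneg : ∃ b, U * PauliW b * Uᴴ = -PauliW b
  · left
    obtain ⟨b, hb⟩ := hneg
    have hshift (a : Q → ZMod 2 × ZMod 2) :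
        (U * PauliW (a + b) * Uᴴ * PauliW (a + b)).trace =
          -(U * PauliW a * Uᴴ * PauliW a).trace := by
      obtain ⟨c, hc, hab⟩ := PauliW_mul a b
      have hW : PauliW (a + b) = star c • (PauliW a * PauliW b) := by
        rw [hab, smul_smul, hc, one_smul]
      have hW' : PauliW (a + b) = c • (PauliW b * PauliW a) := by
        rw [← conjTranspose_PauliW, hW, Matrix.conjTranspose_smul, Matrix.conjTranspose_mul,
          conjTranspose_PauliW, conjTranspose_PauliW, star_star]
      nth_rewrite 2 [hW']
      rw [Matrix.mul_smul, hW, Matrix.mul_smul, Matrix.smul_mul, Matrix.smul_mul, smul_smul,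
        mul_comm c, hc, one_smul, conj_mul_of_conjTranspose_mul h, hb,
        ← Matrix.trace_neg, Matrix.mul_assoc,
        Matrix.neg_mul, ← Matrix.mul_assoc (PauliW b), PauliW_mul_self, one_mul, Matrix.mul_neg]
    have hsum := Equiv.sum_comp (Equiv.addRight b)
      fun a => (U * PauliW a * Uᴴ * PauliW a).trace
    simp only [Equiv.coe_addRight, hshift, Finset.sum_neg_distrib] at hsum
    rw [neg_eq_self, hframe] at hsum
    exact (mul_eq_zero.1 hsum).resolve_left h2
  · right
    have hterm (a : Q → ZMod 2 × ZMod 2) : (U * PauliW a * Uᴴ * PauliW a).trace =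
        if a ∈ pauliFixed U then 2 ^ Fintype.card Q else 0 := by
      split_ifs with ha
      · rw [ha.resolve_right fun hn => hneg ⟨a, hn⟩, trace_PauliW_mul, if_pos rfl]
      · obtain ⟨b, s, hs⟩ := hU a
        have hba : b ≠ a := by
          rintro rfl
          exact ha ((mem_pauliFixed h h').2 ⟨s, hs⟩)
        rw [hs, Matrix.smul_mul, Matrix.trace_smul, trace_PauliW_mul, if_neg hba, smul_zero]
    simp only [hterm] at hframe
    rw [← Finset.sum_filter, Finset.sum_const, nsmul_eq_mul, mul_comm] at hframe
    rw [← mul_left_cancel₀ h2 hframe, Set.ncard_eq_toFinset_card', Set.toFinset]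
    congr 2
    ext a
    simp

theorem pauliFixed_mul_PauliW (a : Q → ZMod 2 × ZMod 2) :
    pauliFixed (U * PauliW a) = pauliFixed U := by
  ext b
  obtain ⟨c, hc, hab⟩ := PauliW_conj_PauliW a b
  have h : U * PauliW a * PauliW b * (U * PauliW a)ᴴ = c • (U * PauliW b * Uᴴ) := by
    rw [← Matrix.smul_mul, ← Matrix.mul_smul, ← hab, Matrix.conjTranspose_mul, conjTranspose_PauliW]
    simp only [Matrix.mul_assoc]
  simp only [pauliFixed, Set.mem_ofPred_eq, h]
  rcases hc with rfl | rfl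
  · rw [one_smul]
  · rw [neg_one_smul, neg_inj, neg_eq_iff_eq_neg, or_comm]

theorem sum_trace_mul_PauliW_pow (h : Uᴴ * U = 1) (h' : U * Uᴴ = 1) (hU : NormalizesPauli U)
    (hent : ∀ x y, U x y ∈ dyadicGaussian) {m : ℕ} (hm : (pauliFixed U).ncard = 2 ^ m)
    {q : ℕ} (hq : q ≠ 0) :
    ∑ a, (U * PauliW a).trace ^ (4 * q) = 2 ^ (2 * Fintype.card Q) * ((-4) ^ q / 2) ^ m := by
  have hdich (a : Q → ZMod 2 × ZMod 2) : (U * PauliW a).trace * star (U * PauliW a).trace = 0 ∨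
      (U * PauliW a).trace * star (U * PauliW a).trace = 2 ^ m := by
    have h1 : (U * PauliW a)ᴴ * (U * PauliW a) = 1 := by
      rw [Matrix.conjTranspose_mul, Matrix.mul_assoc, ← Matrix.mul_assoc Uᴴ, h, one_mul,
        conjTranspose_PauliW, PauliW_mul_self]
    have h2 := trace_mul_star_trace h1 (mul_eq_one_comm.1 h1) (hU.mul (normalizesPauli_PauliW a))
    rw [pauliFixed_mul_PauliW, hm] at h2
    exact_mod_cast h2
  have hmem (a : Q → ZMod 2 × ZMod 2) : (U * PauliW a).trace ∈ dyadicGaussian :=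
    sum_mem fun x _ => sum_mem fun y _ => mul_mem (hent x y)
      (piTensor_mem_dyadicGaussian (fun i => pauli_mem_dyadicGaussian (a i)) y x)
  have hpow (a : Q → ZMod 2 × ZMod 2) : (U * PauliW a).trace ^ (4 * q) =
      (U * PauliW a).trace * star (U * PauliW a).trace * ((-4) ^ q / 2) ^ m := by
    rcases hdich a with h0 | h1
    · rw [h0, zero_mul]
      have : (U * PauliW a).trace = 0 := by simpa using h0
      rw [this, zero_pow (by omega)]
    · rw [h1, pow_mul, pow_four_of_mem_dyadicGaussian (hmem a) h1, ← mul_pow,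
        mul_div_cancel₀ _ two_ne_zero, ← pow_mul, ← pow_mul, mul_comm]
  have hstar (a : Q → ZMod 2 × ZMod 2) :
      star (U * PauliW a).trace = (Uᴴ * PauliW a).trace := by
    rw [← Matrix.trace_conjTranspose, Matrix.conjTranspose_mul, conjTranspose_PauliW,
      Matrix.trace_mul_comm]
  simp only [hpow, hstar, ← Finset.sum_mul]
  rw [sum_trace_mul_trace_PauliW, h', Matrix.trace_one, Fintype.card_fun, ZMod.card]
  push_cast
  ring

end Fixed

theorem trace_tpow_mul_stabProj (n k : ℕ) (U : Matrix (Fin n → ZMod 2) (Fin n → ZMod 2) ℂ) :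
    (tpow U k * stabProj n k).trace =
      ((2 : ℂ) ^ (2 * n))⁻¹ * ∑ a, (U * PauliW a).trace ^ k := by
  rw [stabProj, Matrix.mul_smul, Matrix.trace_smul, Matrix.mul_sum, Matrix.trace_sum, smul_eq_mul]
  congr 1
  refine Finset.sum_congr rfl fun a _ => ?_
  change Matrix.trace (piTensor (fun _ => U) * piTensor fun _ => PauliW a) = _
  rw [piTensor_mul, trace_piTensor, Finset.prod_const, Finset.card_univ, Fintype.card_fin]

/-- For a Clifford unitary `U` and `k` a positive multiple of 4,
the number of `a ∈ 𝔽₂^{2n}` with `U W_a U^† = ±W_a` is a power `2^m`, and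
`tr(U^{⊗k}·P_{n,k}) = ((−4)^{k/4}/2)^m`; in particular for `k = 4`,
`tr(U^{⊗4}·P_{n,4}) = (−2)^m`. -/
theorem stmt10 (n k : ℕ) (hn : 1 ≤ n) (hk : 0 < k) (h4 : 4 ∣ k)
    (U : Matrix.unitaryGroup (Fin n → ZMod 2) ℂ) (hU : U ∈ CliffordGroup n) :
    ∃ m : ℕ,
      Set.ncard {a : Fin n → ZMod 2 × ZMod 2 |
          (U : Matrix (Fin n → ZMod 2) (Fin n → ZMod 2) ℂ) * PauliW a *
              (U : Matrix (Fin n → ZMod 2) (Fin n → ZMod 2) ℂ).conjTranspose = PauliW a ∨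
            (U : Matrix (Fin n → ZMod 2) (Fin n → ZMod 2) ℂ) * PauliW a *
              (U : Matrix (Fin n → ZMod 2) (Fin n → ZMod 2) ℂ).conjTranspose = -PauliW a}
        = 2 ^ m ∧
      Matrix.trace
          (tpow ((U : Matrix (Fin n → ZMod 2) (Fin n → ZMod 2) ℂ)) k * stabProj n k)
        = (((-4 : ℂ) ^ (k / 4)) / 2) ^ m ∧
      (k = 4 →
        Matrix.trace
            (tpow ((U : Matrix (Fin n → ZMod 2) (Fin n → ZMod 2) ℂ)) 4 * stabProj n 4)
          = (-2 : ℂ) ^ m) := by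

  have h : (U : Matrix (Fin n → ZMod 2) (Fin n → ZMod 2) ℂ)ᴴ * U = 1 :=
    Matrix.mem_unitaryGroup_iff'.1 U.2
  have h' : (U : Matrix (Fin n → ZMod 2) (Fin n → ZMod 2) ℂ) * (U : Matrix _ _ ℂ)ᴴ = 1 :=
    Matrix.mem_unitaryGroup_iff.1 U.2
  obtain ⟨m, hm⟩ := card_pauliFixed h h'
  have key (q : ℕ) (hq : q ≠ 0) :
      (tpow (U : Matrix (Fin n → ZMod 2) (Fin n → ZMod 2) ℂ) (4 * q) *
        stabProj n (4 * q)).trace = ((-4) ^ q / 2) ^ m := by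
    rw [trace_tpow_mul_stabProj, sum_trace_mul_PauliW_pow h h'
      (normalizesPauli_of_mem_CliffordGroup hU) (mem_dyadicGaussian_of_mem_CliffordGroup hU) hm hq,
      Fintype.card_fin, inv_mul_cancel_left₀ (pow_ne_zero _ two_ne_zero)]
  refine ⟨m, hm, ?_, fun _ => ?_⟩
  · obtain ⟨q, rfl⟩ := h4
    rw [Nat.mul_div_cancel_left q (by norm_num)]
    exact key q (by omega)
  · rw [key 1 one_ne_zero]
    norm_num

end
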